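/- arXiv:2001.08327 — 11 statements merged into one kernel-verified Lean document; each statement's English description precedes it below -/
import Mathlib

section
/- Let λ > 0 and let β be a nonzero real number. Then ∫₀^∞ [(η/(2β²))·1{|β| > η}] · [λ²·η^{−3}·e^{−λ/η}] dη = (λ/(2β²))·e^{−λ/|β|}. That is, mixing the double Pareto DP(η, 1) density for β over an Inverse Gamma(2, λ) distribution for the scale η yields the IDE(λ) density (Proposition 1, the scale-mixture-of-double-Pareto representation of the reciprocal LASSO prior). -/
open MeasureTheory Real Set

/-- Proposition 1 (SMDP representation): mixing the double Pareto DP(η, 1) density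
for β over an Inverse Gamma(2, λ) distribution for the scale η yields the IDE(λ)
density. -/
theorem stmt_0 (lam β : ℝ) (hlam : 0 < lam) (hβ : β ≠ 0) :
    ∫ η in Ioi (0 : ℝ),
        ((η / (2 * β ^ 2)) * (if η < |β| then (1 : ℝ) else 0)) *
          (lam ^ 2 * η ^ (-3 : ℤ) * Real.exp (-lam / η))
      = (lam / (2 * β ^ 2)) * Real.exp (-lam / |β|) := by
  have hb : 0 < |β| := abs_pos.mpr hβ
  have hβ2 : 0 < β ^ 2 := by positivity
  let h : ℝ → ℝ := fun η => (η / (2 * β ^ 2)) * (lam ^ 2 * η ^ (-3 : ℤ) * Real.exp (-lam / η))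
  let g : ℝ → ℝ := fun x => if x ≤ 0 then 0 else (lam / (2 * β ^ 2)) * Real.exp (-lam / x)
  have e1 : (fun η : ℝ => ((η / (2 * β ^ 2)) * (if η < |β| then (1 : ℝ) else 0)) *
          (lam ^ 2 * η ^ (-3 : ℤ) * Real.exp (-lam / η))) = (Iio |β|).indicator h := by
    funext η
    by_cases hη : η < |β| <;> simp [h, hη]
  have hder : ∀ x : ℝ, 0 < x → HasDerivAt g (h x) x := by
    intro x hx
    have h1 : HasDerivAt (fun x : ℝ => (lam / (2 * β ^ 2)) * Real.exp (-lam / x)) (h x) x := by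
      have h2 := (((hasDerivAt_inv hx.ne').const_mul (-lam)).exp).const_mul (lam / (2 * β ^ 2))
      have hz : x ^ (-3 : ℤ) = (x ^ 3)⁻¹ := by
        rw [zpow_neg]; norm_cast
      have h4 : HasDerivAt (fun x : ℝ => (lam / (2 * β ^ 2)) * Real.exp (-lam / x)) _ x := h2
      refine h4.congr_deriv ?_
      change _ = (x / (2 * β ^ 2)) * (lam ^ 2 * x ^ (-3 : ℤ) * Real.exp (-lam / x))
      rw [hz, div_eq_mul_inv (-lam) x]
      field_simp
    refine h1.congr_of_eventuallyEq ?_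
    filter_upwards [Ioi_mem_nhds hx] with y hy
    simp [g, not_le.mpr (mem_Ioi.mp hy)]
  have hcont : ContinuousOn g (Icc 0 |β|) := by
    intro x hx
    rcases hx.1.eq_or_lt with rfl | hx0
    · refine ContinuousWithinAt.mono ?_ Icc_subset_Ici_self
      refine continuousWithinAt_Ioi_iff_Ici.mp ?_
      have h3 : Filter.Tendsto (fun x : ℝ => (lam / (2 * β ^ 2)) * Real.exp (-lam / x))
          (nhdsWithin 0 (Ioi 0)) (nhds ((lam / (2 * β ^ 2)) * 0)) := by
        refine Filter.Tendsto.const_mul _ (Real.tendsto_exp_atBot.comp ?_)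
        change Filter.Tendsto (fun x : ℝ => -lam * x⁻¹) _ _
        exact tendsto_inv_nhdsGT_zero.const_mul_atTop_of_neg (by linarith)
      have : g 0 = (lam / (2 * β ^ 2)) * 0 := by simp [g]
      rw [ContinuousWithinAt, this]
      refine h3.congr' ?_
      filter_upwards [self_mem_nhdsWithin] with y hy
      simp [g, not_le.mpr (mem_Ioi.mp hy)]
    · exact (hder x hx0).continuousAt.continuousWithinAt
  have hpos : ∀ x ∈ Ioo 0 |β|, 0 ≤ h x := by
    intro x hx
    have := hx.1
    positivity
  have hInt := intervalIntegral.integrableOn_deriv_of_nonneg hcont (fun x hx => hder x hx.1) hpos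
  rw [e1, setIntegral_indicator measurableSet_Iio, Ioi_inter_Iio, ← integral_Ioc_eq_integral_Ioo,
    ← intervalIntegral.integral_of_le hb.le,
    intervalIntegral.integral_eq_sub_of_hasDerivAt_of_le hb.le hcont (fun x hx => hder x hx.1)
      ((intervalIntegrable_iff_integrableOn_Ioc_of_le hb.le).mpr hInt)]
  simp [g, hβ]
end

section
/- Let λ > 0 and let β be a nonzero real number. Then ∫₀^∞ ∫₀^∞ [(ζ/2)·e^{−ζ(|β|−η)}·1{|β| > η}] · [η·e^{−ηζ}] · [λ²·η^{−3}·e^{−λ/η}] dζ dη = (λ/(2β²))·e^{−λ/|β|}. That is, mixing the truncated Laplace density for β (rate ζ, truncated to |β| > η) over an Exponential(rate η) distribution for ζ and an Inverse Gamma(2, λ) distribution for η yields the IDE(λ) density (the integral identity underlying Proposition 2, the scale-mixture-of-truncated-distributions representation of the reciprocal LASSO prior). -/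
open MeasureTheory Real Set

lemma inner_aux (b : ℝ) (hb : 0 < b) :
    ∫ ζ in Ioi (0 : ℝ), ζ * Real.exp (-(b * ζ)) = 1 / b ^ 2 := by
  have h := Real.integral_rpow_mul_exp_neg_mul_Ioi (a := 2) (r := b) (by norm_num) hb
  have h1 : (2 : ℝ) - 1 = 1 := by norm_num
  rw [h1] at h
  simp only [Real.rpow_one, Real.Gamma_two, mul_one] at h
  rw [h, Real.rpow_two, one_div_pow]

lemma outer_aux (lam b : ℝ) (hlam : 0 < lam) (hb : 0 < b) :
    ∫ η in Ioo (0 : ℝ) b, lam ^ 2 / η ^ 2 * Real.exp (-lam / η) = lam * Real.exp (-lam / b) := by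
  have hint : IntegrableOn (fun η : ℝ => lam ^ 2 / η ^ 2 * Real.exp (-lam / η)) (Ioc 0 b) := by
    refine Measure.integrableOn_of_bounded (M := 2) (by simp) ?_ ?_
    · exact Measurable.aestronglyMeasurable (by fun_prop)
    · refine (ae_restrict_iff' measurableSet_Ioc).2 (Filter.Eventually.of_forall ?_)
      intro x hx
      have hx0 : 0 < x := hx.1
      rw [Real.norm_of_nonneg (by positivity)]
      have h := Real.quadratic_le_exp_of_nonneg (x := lam / x) (by positivity)
      have h0 : 0 < lam / x := by positivity
      rw [neg_div, Real.exp_neg, ← div_pow, ← div_eq_mul_inv, div_le_iff₀ (Real.exp_pos _)]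
      linarith
  rw [← integral_Ioc_eq_integral_Ioo, ← intervalIntegral.integral_of_le hb.le]
  have key := intervalIntegral.integral_eq_sub_of_hasDerivAt_of_tendsto
    (f := fun η : ℝ => lam * Real.exp (-lam / η)) (fa := 0) (fb := lam * Real.exp (-lam / b))
    (f' := fun η : ℝ => lam ^ 2 / η ^ 2 * Real.exp (-lam / η)) hb ?_
    ((intervalIntegrable_iff_integrableOn_Ioc_of_le hb.le).2 hint) ?_ ?_
  · rw [key, sub_zero]
  · intro x hx
    have hx0 : x ≠ 0 := hx.1.ne'
    have h := (((hasDerivAt_const x (-lam)).div (hasDerivAt_id x) hx0).exp).const_mul lam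
    refine h.congr_deriv ?_
    simp
    ring
  · have h1 : Filter.Tendsto (fun η : ℝ => -lam / η) (nhdsWithin 0 (Ioi 0)) Filter.atBot := by
      simp only [div_eq_mul_inv]
      exact tendsto_inv_nhdsGT_zero.const_mul_atTop_of_neg (by linarith)
    simpa using (Real.tendsto_exp_atBot.comp h1).const_mul lam
  · have : ContinuousAt (fun η : ℝ => lam * Real.exp (-lam / η)) b := by
      have := hb.ne'
      fun_prop (disch := assumption)
    exact this.tendsto.mono_left nhdsWithin_le_nhds

/-- The integral identity underlying Proposition 2 (SMTN representation): mixing the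
truncated Laplace density for β (rate ζ, truncated to |β| > η) over an
Exponential(rate η) distribution for ζ and an Inverse Gamma(2, λ) distribution for η
yields the IDE(λ) density. -/
theorem stmt_1 (lam β : ℝ) (hlam : 0 < lam) (hβ : β ≠ 0) :
    ∫ η in Ioi (0 : ℝ), ∫ ζ in Ioi (0 : ℝ),
        ((ζ / 2) * Real.exp (-ζ * (|β| - η)) * (if η < |β| then (1 : ℝ) else 0)) *
          (η * Real.exp (-η * ζ)) *
          (lam ^ 2 * η ^ (-3 : ℤ) * Real.exp (-lam / η))
      = (lam / (2 * β ^ 2)) * Real.exp (-lam / |β|) := by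
  have hb : 0 < |β| := abs_pos.2 hβ
  have hsq : β ^ 2 = |β| ^ 2 := (sq_abs β).symm
  rw [hsq]
  generalize |β| = b at *
  have step : ∀ η ∈ Ioi (0 : ℝ), (∫ ζ in Ioi (0 : ℝ),
        ((ζ / 2) * Real.exp (-ζ * (b - η)) * (if η < b then (1 : ℝ) else 0)) *
          (η * Real.exp (-η * ζ)) *
          (lam ^ 2 * η ^ (-3 : ℤ) * Real.exp (-lam / η)))
      = (Iio b).indicator
          (fun η => 1 / (2 * b ^ 2) * (lam ^ 2 / η ^ 2 * Real.exp (-lam / η))) η := by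
    intro η hη
    have hη0 : η ≠ 0 := (ne_of_gt hη)
    by_cases h : η < b
    · rw [indicator_of_mem (show η ∈ Iio b from h)]
      have e : ∀ ζ : ℝ, ((ζ / 2) * Real.exp (-ζ * (b - η)) * (if η < b then (1 : ℝ) else 0)) *
          (η * Real.exp (-η * ζ)) *
          (lam ^ 2 * η ^ (-3 : ℤ) * Real.exp (-lam / η))
          = (1 / 2 * (lam ^ 2 / η ^ 2 * Real.exp (-lam / η))) * (ζ * Real.exp (-(b * ζ))) := by
        intro ζ
        have h2 : Real.exp (-(b * ζ)) = Real.exp (-ζ * (b - η)) * Real.exp (-η * ζ) := by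
          rw [← Real.exp_add]; congr 1; ring
        have h3 : η ^ (-3 : ℤ) = 1 / η ^ 3 := by
          rw [zpow_neg, one_div]; norm_cast
        rw [h2, h3, if_pos h]
        field_simp
      simp_rw [e]
      rw [integral_const_mul, inner_aux b hb]
      field_simp
    · rw [indicator_of_notMem (show η ∉ Iio b from h)]
      simp [h]
  rw [setIntegral_congr_fun measurableSet_Ioi step, setIntegral_indicator measurableSet_Iio,
    Ioi_inter_Iio, integral_const_mul, outer_aux lam b hlam hb]
  field_simp
end

section
/- Let η > 0 and let β be a real number with |β| > η. Then ∫₀^∞ [(ζ/2)·e^{−ζ(|β|−η)}] · [η·e^{−ηζ}] dζ = η/(2β²). That is, mixing the truncated Laplace density for β (rate ζ, truncated to |β| > η) over an Exponential(rate η) distribution for ζ yields the double Pareto DP(η, 1) density at β (the intermediate mixing step in the proof of Proposition 2). -/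
open MeasureTheory Real Set

/-- The intermediate mixing step in the proof of Proposition 2: mixing the truncated
Laplace density for β (rate ζ, truncated to |β| > η) over an Exponential(rate η)
distribution for ζ yields the double Pareto DP(η, 1) density at β. -/
theorem stmt_3 (η β : ℝ) (hη : 0 < η) (hβ : η < |β|) :
    ∫ ζ in Ioi (0 : ℝ),
        ((ζ / 2) * Real.exp (-ζ * (|β| - η))) * (η * Real.exp (-η * ζ))
      = η / (2 * β ^ 2) := by
  have hb : 0 < |β| := hη.trans hβ
  have h := Real.integral_rpow_mul_exp_neg_mul_Ioi (a := 2) (r := |β|) (by norm_num) hb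
  have h2 : ∀ ζ : ℝ, ((ζ / 2) * Real.exp (-ζ * (|β| - η))) * (η * Real.exp (-η * ζ))
      = (η / 2) * (ζ ^ ((2 : ℝ) - 1) * Real.exp (-(|β| * ζ))) := by
    intro ζ
    have h3 : Real.exp (-(|β| * ζ)) = Real.exp (-ζ * (|β| - η)) * Real.exp (-η * ζ) := by
      rw [← Real.exp_add]
      congr 1
      ring
    have h4 : ζ ^ ((2 : ℝ) - 1) = ζ := by
      rw [show (2 : ℝ) - 1 = 1 by norm_num, Real.rpow_one]
    rw [h3, h4]
    ring
  simp_rw [h2]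
  rw [integral_const_mul, h, Real.Gamma_two, Real.rpow_two, div_pow, sq_abs]
  have hb' : β ≠ 0 := abs_pos.mp hb
  field_simp
end

section
/- Let α > 0, η > 0, μ ≥ 0, and let β be a real number with |β| > μ. Then ∫₀^∞ [(ζ/2)·e^{−ζ(|β|−μ)}] · [(η^α/Γ(α))·ζ^{α−1}·e^{−ηζ}] dζ = (α/(2η))·(1 + (|β|−μ)/η)^{−(α+1)}, which is the generalized double Pareto GDP(μ, ξ, α) density at β with scale ξ = η/α. That is, mixing the Laplace density truncated to |β| > μ (rate ζ) over a Gamma(α, η) distribution for ζ yields the GDP(μ, η/α, α) density (the mixture identity in Lemma 1, after integrating out the normal variance stage). -/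
open MeasureTheory Real Set

/-- The mixture identity in Lemma 1 (after integrating out the normal variance stage):
mixing the Laplace density truncated to |β| > μ (rate ζ) over a Gamma(α, η)
distribution for ζ yields the generalized double Pareto GDP(μ, η/α, α) density. -/
theorem stmt_4 (α η μ β : ℝ) (hα : 0 < α) (hη : 0 < η) (hμ : 0 ≤ μ) (hβ : μ < |β|) :
    ∫ ζ in Ioi (0 : ℝ),
        ((ζ / 2) * Real.exp (-ζ * (|β| - μ))) *
          ((η ^ α / Real.Gamma α) * ζ ^ (α - 1) * Real.exp (-η * ζ))
      = (α / (2 * η)) * (1 + (|β| - μ) / η) ^ (-(α + 1)) := by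
  obtain ⟨d, hd⟩ : ∃ d, d = |β| - μ := ⟨_, rfl⟩
  rw [← hd]
  have hd0 : 0 < d := by rw [hd]; linarith
  have hs : 0 < η + d := by positivity
  have hG : Real.Gamma α ≠ 0 := (Real.Gamma_pos_of_pos hα).ne'
  have key := Real.integral_rpow_mul_exp_neg_mul_Ioi (a := α + 1) (r := η + d)
    (by positivity) hs
  have hcongr : ∫ ζ in Ioi (0 : ℝ),
        ((ζ / 2) * Real.exp (-ζ * d)) *
          ((η ^ α / Real.Gamma α) * ζ ^ (α - 1) * Real.exp (-η * ζ))
      = ∫ ζ in Ioi (0 : ℝ), (η ^ α / (2 * Real.Gamma α)) *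
          (ζ ^ (α + 1 - 1) * Real.exp (-((η + d) * ζ))) := by
    refine setIntegral_congr_fun measurableSet_Ioi (fun t ht => ?_)
    have ht0 : 0 < t := ht
    have h1 : t ^ (α + 1 - 1) = t ^ (α - 1) * t := by
      rw [← Real.rpow_add_one ht0.ne']
      congr 1
      ring
    have h2 : Real.exp (-((η + d) * t)) = Real.exp (-t * d) * Real.exp (-η * t) := by
      rw [← Real.exp_add]
      congr 1
      ring
    simp only [h1, h2]
    field_simp
  rw [hcongr, integral_const_mul, key, Real.Gamma_add_one hα.ne']
  have h3 : (1 + d / η) = (η + d) / η := by field_simp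
  rw [h3, Real.rpow_neg (by positivity), Real.div_rpow hs.le hη.le,
    Real.div_rpow zero_le_one hs.le, Real.one_rpow, Real.rpow_add_one hη.ne']
  have h4 : (η + d) ^ (α + 1) ≠ 0 := (Real.rpow_pos_of_pos hs _).ne'
  have h5 : η ^ α ≠ 0 := (Real.rpow_pos_of_pos hη _).ne'
  field_simp
end

section
/- Let f : ℝ → ℝ be symmetric about the origin, integrable on (0, ∞), convex and twice continuously differentiable on (0, ∞), with f(0) = 1, f(s) → 0 and s·f′(s) → 0 as s → ∞. Let C = (2∫₀^∞ f(t) dt)^{−1}. Then for every nonzero real t: C·f(1/t)/t² = ∫₀^∞ (1/(s·t²)) · max(1 − 1/(s·|t|), 0) · C·s²·f″(s) ds. (Corollary 1: the case k = 2 of the reciprocal Bartlett–Fejér mixture representation.) -/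
open MeasureTheory Real Set Filter

/-- Corollary 1: the case k = 2 of the reciprocal Bartlett–Fejér mixture
representation. -/
theorem stmt_6 (f : ℝ → ℝ)
    (hsymm : ∀ x : ℝ, f (-x) = f x)
    (hint : IntegrableOn f (Ioi 0))
    (hconv : ConvexOn ℝ (Ioi 0) f)
    (hsmooth : ContDiffOn ℝ 2 f (Ioi 0))
    (hf0 : f 0 = 1)
    (htail0 : Tendsto f atTop (nhds 0))
    (htail1 : Tendsto (fun s : ℝ => s * deriv f s) atTop (nhds 0))
    (C : ℝ) (hC : C = (2 * ∫ t in Ioi (0 : ℝ), f t)⁻¹) :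
    ∀ t : ℝ, t ≠ 0 →
      C * f (1 / t) / t ^ 2 =
        ∫ s in Ioi (0 : ℝ),
          (1 / (s * t ^ 2)) * max (1 - 1 / (s * |t|)) 0 *
            (C * s ^ 2 * deriv (deriv f) s) := by
  intro t ht
  have hta : 0 < |t| := abs_pos.mpr ht
  obtain ⟨a, ha⟩ : ∃ a : ℝ, a = 1 / |t| := ⟨_, rfl⟩
  have ha0 : 0 < a := by rw [ha]; positivity
  have hfa : f (1 / t) = f a := by
    rw [ha]
    rcases abs_choice t with h | h
    · rw [h]
    · rw [h, one_div_neg_eq_neg_one_div, hsymm]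
  have hd1 : ∀ x ∈ Ioi (0 : ℝ), HasDerivAt f (deriv f x) x := fun x hx =>
    ((hsmooth.differentiableOn (by norm_num)).differentiableAt (Ioi_mem_nhds hx)).hasDerivAt
  have hsm1 : ContDiffOn ℝ 1 (deriv f) (Ioi 0) :=
    hsmooth.deriv_of_isOpen isOpen_Ioi (by norm_num)
  have hd2 : ∀ x ∈ Ioi (0 : ℝ), HasDerivAt (deriv f) (deriv (deriv f) x) x := fun x hx =>
    ((hsm1.differentiableOn (by norm_num)).differentiableAt (Ioi_mem_nhds hx)).hasDerivAt
  have hmono : MonotoneOn (deriv f) (Ioi 0) :=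
    hconv.monotoneOn_deriv (fun x hx => (hd1 x hx).differentiableAt)
  have hpos : ∀ x ∈ Ioi (0 : ℝ), 0 ≤ deriv (deriv f) x := by
    intro x hx
    have h := hmono.derivWithin_nonneg (x := x)
    rwa [derivWithin_of_isOpen isOpen_Ioi hx] at h
  have hderiv : ∀ x ∈ Ici a, HasDerivAt (fun s => (s - a) * deriv f s - f s)
      ((x - a) * deriv (deriv f) x) x := by
    intro x hx
    have hx0 : x ∈ Ioi (0 : ℝ) := lt_of_lt_of_le ha0 hx
    have h : HasDerivAt (fun s => (s - a) * deriv f s - f s)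
        (1 * deriv f x + (x - a) * deriv (deriv f) x - deriv f x) x := (((hasDerivAt_id x).sub_const a).mul (hd2 x hx0)).sub (hd1 x hx0)
    exact h.congr_deriv (by ring)
  have hlim' : Tendsto (deriv f) atTop (nhds 0) := by
    have h := htail1.mul tendsto_inv_atTop_zero
    rw [mul_zero] at h
    refine h.congr' ?_
    filter_upwards [eventually_gt_atTop (0 : ℝ)] with s hs
    field_simp
  have hlim : Tendsto (fun s => (s - a) * deriv f s - f s) atTop (nhds 0) := by
    have h := (htail1.sub (hlim'.const_mul a)).sub htail0
    simp only [mul_zero, sub_zero] at h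
    refine h.congr fun s => ?_
    ring
  have hI := integral_Ioi_of_hasDerivAt_of_nonneg' hderiv
    (fun x hx => mul_nonneg (sub_nonneg.mpr (le_of_lt hx)) (hpos x (lt_trans ha0 hx))) hlim
  have key : ∫ s in Ioi (0 : ℝ), (1 / (s * t ^ 2)) * max (1 - 1 / (s * |t|)) 0 *
            (C * s ^ 2 * deriv (deriv f) s) =
      ∫ s in Ioi a, (C / t ^ 2) * ((s - a) * deriv (deriv f) s) := by
    refine (setIntegral_eq_of_subset_of_forall_sdiff_eq_zero measurableSet_Ioi
      (Ioi_subset_Ioi ha0.le) ?_).trans ?_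
    rotate_left
    · refine setIntegral_congr_fun measurableSet_Ioi fun s hs => ?_
      have hs' : a < s := hs
      have hs0 : 0 < s := ha0.trans hs'
      have e : 1 / (s * |t|) = a / s := by rw [ha]; field_simp
      have : a / s ≤ 1 := (div_le_one hs0).mpr hs'.le
      beta_reduce
      rw [e, max_eq_left (by linarith)]
      field_simp
    · intro s hs
      have hs0 : 0 < s := hs.1
      have hs' : s ≤ a := not_lt.mp hs.2
      have e : 1 / (s * |t|) = a / s := by rw [ha]; field_simp
      have : 1 ≤ a / s := (one_le_div hs0).mpr hs'
      rw [e, max_eq_right (by linarith)]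
      simp
  rw [key, integral_const_mul, hI, hfa]
  ring
end

section
/- Let f : ℝ → ℝ be symmetric about the origin, integrable on (0, ∞), nonincreasing and once continuously differentiable on (0, ∞), with f(0) = 1 and f(s) → 0 as s → ∞. Let C = (2∫₀^∞ f(t) dt)^{−1}. Then for every nonzero real t: C·f(1/t)/t² = ∫₀^∞ (1/(s·t²)) · 1{|t| > 1/s} · (−C·s·f′(s)) ds, where −C·s·f′(s) ≥ 0 since f is nonincreasing on (0, ∞). (Corollary 2: the case k = 1, expressing any reciprocal monotone density as a scale mixture of double Pareto (inverse uniform) densities.) -/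
open MeasureTheory Real Set Filter

/-- Corollary 2: the case k = 1, expressing any reciprocal monotone density as a scale
mixture of double Pareto (inverse uniform) densities. -/
theorem stmt_7 (f : ℝ → ℝ)
    (hsymm : ∀ x : ℝ, f (-x) = f x)
    (hint : IntegrableOn f (Ioi 0))
    (hanti : AntitoneOn f (Ioi 0))
    (hsmooth : ContDiffOn ℝ 1 f (Ioi 0))
    (hf0 : f 0 = 1)
    (htail : Tendsto f atTop (nhds 0))
    (C : ℝ) (hC : C = (2 * ∫ t in Ioi (0 : ℝ), f t)⁻¹) :
    ∀ t : ℝ, t ≠ 0 →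
      C * f (1 / t) / t ^ 2 =
        ∫ s in Ioi (0 : ℝ),
          (1 / (s * t ^ 2)) * (if 1 / s < |t| then (1 : ℝ) else 0) *
            (-C * s * deriv f s) := by
  intro t ht
  have hta : 0 < |t| := abs_pos.mpr ht
  have ha : 0 < 1 / |t| := by positivity
  have hfa : f (1 / t) = f (1 / |t|) := by
    rcases abs_choice t with h | h
    · rw [h]
    · rw [h, one_div_neg_eq_neg_one_div, hsymm]
  have hd : ∀ x ∈ Ioi (0 : ℝ), HasDerivAt f (deriv f x) x := fun x hx =>
    ((hsmooth.differentiableOn (by norm_num)).differentiableAt (Ioi_mem_nhds hx)).hasDerivAt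
  have hneg : ∀ x ∈ Ioi (0 : ℝ), deriv f x ≤ 0 := by
    intro x hx
    rw [← derivWithin_of_isOpen isOpen_Ioi hx]
    exact hanti.derivWithin_nonpos
  have key : ∫ x in Ioi (1 / |t|), deriv f x = 0 - f (1 / |t|) :=
    integral_Ioi_of_hasDerivAt_of_nonpos' (fun x hx => hd x (lt_of_lt_of_le ha hx))
      (fun x hx => hneg x (lt_trans ha hx)) htail
  have h1 : ∫ s in Ioi (0 : ℝ),
          (1 / (s * t ^ 2)) * (if 1 / s < |t| then (1 : ℝ) else 0) *
            (-C * s * deriv f s) =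
      ∫ s in Ioi (0 : ℝ), (Ioi (1 / |t|)).indicator (fun s => (-C / t ^ 2) * deriv f s) s := by
    refine setIntegral_congr_fun measurableSet_Ioi ?_
    intro s hs
    have hs' : (0 : ℝ) < s := hs
    have hiff : 1 / s < |t| ↔ s ∈ Ioi (1 / |t|) := by
      rw [mem_Ioi, div_lt_iff₀ hs', div_lt_iff₀ hta, mul_comm]
    by_cases h : 1 / s < |t|
    · simp only [if_pos h, indicator_of_mem (hiff.mp h)]
      field_simp
    · simp only [if_neg h, indicator_of_notMem (fun h' => h (hiff.mpr h'))]
      ring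
  rw [h1, setIntegral_indicator measurableSet_Ioi,
    inter_eq_self_of_subset_right (Ioi_subset_Ioi ha.le), integral_const_mul, key, hfa]
  ring
end

section
/- Let α > 0, λ > 0, and let β be a nonzero real number. Then ∫₀^∞ [(η^{1/α}/(2β²))·1{|β| > η^{1/α}}] · [(λ^{(1/α)+1}/Γ((1/α)+1))·η^{−(1/α)−2}·e^{−λ/η}] dη = (λ^{1/α}/(2β²·Γ((1/α)+1)))·e^{−λ·|β|^{−α}}. That is, mixing the double Pareto DP(η^{1/α}, 1) density for β over an Inverse Gamma((1/α)+1, λ) distribution for η yields the Inverse Generalized Gaussian IGG(α, λ) density, the prior inducing the reciprocal bridge penalty. -/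
open MeasureTheory Real Set

lemma aux_deriv (lam x : ℝ) (hx : 0 < x) :
    HasDerivAt (fun y : ℝ => if y = 0 then (0 : ℝ) else Real.exp (-lam / y))
      (lam * x ^ (-2 : ℝ) * Real.exp (-lam / x)) x := by
  have h1 : HasDerivAt (fun y : ℝ => Real.exp (-lam / y))
      (lam * x ^ (-2 : ℝ) * Real.exp (-lam / x)) x := by
    have h := ((hasDerivAt_inv hx.ne').const_mul (-lam)).exp
    have h2 : x ^ (-2 : ℝ) = (x ^ 2)⁻¹ := by
      rw [Real.rpow_neg hx.le]; norm_num
    rw [h2]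
    simp only [div_eq_mul_inv]
    refine h.congr_deriv ?_
    ring
  refine h1.congr_of_eventuallyEq ?_
  filter_upwards [isOpen_ne.mem_nhds hx.ne'] with y hy
  exact if_neg hy

lemma aux_cont (lam M : ℝ) (hlam : 0 < lam) :
    ContinuousOn (fun y : ℝ => if y = 0 then (0 : ℝ) else Real.exp (-lam / y)) (Icc 0 M) := by
  intro x hx
  rcases hx.1.eq_or_lt with rfl | h
  · have : Icc (0:ℝ) M ⊆ insert 0 (Ioi 0) := by
      intro y hy
      rcases hy.1.eq_or_lt with h | h
      · left; exact h.symm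
      · right; exact h
    refine ContinuousWithinAt.mono ?_ this
    rw [continuousWithinAt_insert_self]
    unfold ContinuousWithinAt
    simp only [if_true]
    have h1 : Filter.Tendsto (fun y : ℝ => Real.exp (-lam / y)) (nhdsWithin 0 (Ioi 0)) (nhds 0) := by
      refine Real.tendsto_exp_atBot.comp ?_
      change Filter.Tendsto (fun y : ℝ => -lam * y⁻¹) _ _
      exact tendsto_inv_nhdsGT_zero.const_mul_atTop_of_neg (by linarith)
    refine h1.congr' ?_
    filter_upwards [self_mem_nhdsWithin] with y hy
    exact (if_neg (ne_of_gt hy)).symm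
  · exact (aux_deriv lam x h).continuousAt.continuousWithinAt

lemma aux_int (lam M : ℝ) (hlam : 0 < lam) (hM : 0 < M) :
    ∫ x in Ioo 0 M, lam * x ^ (-2 : ℝ) * Real.exp (-lam / x) = Real.exp (-lam / M) := by
  rw [← integral_Ioc_eq_integral_Ioo, ← intervalIntegral.integral_of_le hM.le]
  rw [intervalIntegral.integral_eq_sub_of_hasDerivAt_of_le hM.le (aux_cont lam M hlam)
    (fun x hx => aux_deriv lam x hx.1)]
  · simp [hM.ne']
  · rw [intervalIntegrable_iff_integrableOn_Ioc_of_le hM.le]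
    refine intervalIntegral.integrableOn_deriv_of_nonneg (aux_cont lam M hlam)
      (fun x hx => aux_deriv lam x hx.1) ?_
    intro x hx
    have := hx.1
    positivity

/-- Mixing the double Pareto DP(η^{1/α}, 1) density for β over an
Inverse Gamma((1/α)+1, λ) distribution for η yields the Inverse Generalized Gaussian
IGG(α, λ) density, the prior inducing the reciprocal bridge penalty. -/
theorem stmt_8 (α lam β : ℝ) (hα : 0 < α) (hlam : 0 < lam) (hβ : β ≠ 0) :
    ∫ η in Ioi (0 : ℝ),
        ((η ^ (1 / α) / (2 * β ^ 2)) * (if η ^ (1 / α) < |β| then (1 : ℝ) else 0)) *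
          ((lam ^ (1 / α + 1) / Real.Gamma (1 / α + 1)) *
            η ^ (-(1 / α) - 2) * Real.exp (-lam / η))
      = (lam ^ (1 / α) / (2 * β ^ 2 * Real.Gamma (1 / α + 1))) *
          Real.exp (-lam * |β| ^ (-α)) := by
  have hb : 0 < |β| := abs_pos.mpr hβ
  have hM : 0 < |β| ^ α := Real.rpow_pos_of_pos hb α
  have hG : 0 < Real.Gamma (1 / α + 1) := Real.Gamma_pos_of_pos (by positivity)
  have key : ∀ η ∈ Ioi (0 : ℝ),
      ((η ^ (1 / α) / (2 * β ^ 2)) * (if η ^ (1 / α) < |β| then (1 : ℝ) else 0)) *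
          ((lam ^ (1 / α + 1) / Real.Gamma (1 / α + 1)) *
            η ^ (-(1 / α) - 2) * Real.exp (-lam / η))
      = (lam ^ (1 / α) / (2 * β ^ 2 * Real.Gamma (1 / α + 1))) *
        (Iio (|β| ^ α)).indicator (fun x => lam * x ^ (-2 : ℝ) * Real.exp (-lam / x)) η := by
    intro η hη
    have hη : 0 < η := hη
    have hiff : η ^ (1 / α) < |β| ↔ η < |β| ^ α := by
      rw [one_div, Real.rpow_inv_lt_iff_of_pos hη.le hb.le hα]
    by_cases h : η < |β| ^ α
    · rw [if_pos (hiff.2 h), indicator_of_mem (show η ∈ Iio _ from h)]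
      have e1 : η ^ (-2 : ℝ) = η ^ (1 / α) * η ^ (-(1 / α) - 2) := by
        rw [← Real.rpow_add hη]; congr 1; ring
      rw [e1, Real.rpow_add hlam, Real.rpow_one]
      field_simp
    · rw [if_neg (fun h' => h (hiff.1 h')), indicator_of_notMem (show η ∉ Iio _ from h)]
      simp
  rw [setIntegral_congr_fun measurableSet_Ioi key, integral_const_mul,
    setIntegral_indicator measurableSet_Iio, Ioi_inter_Iio, aux_int lam _ hlam hM,
    Real.rpow_neg hb.le, div_eq_mul_inv (-lam)]
end

section
/- Let α > 0, λ > 0, and let β be a nonzero real number. Then (λ^{1/α}/(2β²·Γ((1/α)+1)))·e^{−λ·|β|^{−α}} = ∫₀^∞ (λ^{1/α}/(β²·w^{1/α})) · max(1 − λ^{1/α}/(|β|·w^{1/α}), 0) · p(w | α) dw, where p(w | α) = ((1+α)/2)·(1/Γ(2 + 1/α))·w^{1 + 1/α}·e^{−w} + ((1−α)/2)·(1/Γ(1 + 1/α))·w^{1/α}·e^{−w}. (The alternative representation of the reciprocal bridge prior as a mixture of reciprocal Bartlett–Fejér kernels over a two-component gamma mixing measure, with normalizing constants c₁ = 1/Γ(2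 + 1/α) and c₂ = 1/Γ(1 + 1/α).) -/
open MeasureTheory Real Set

lemma aux_int_s9 (α T : ℝ) (hα : 0 < α) (hT : 0 < T) :
    ∫ w in Ioi T, (1 - T ^ (1 / α) * w ^ (-(1 / α))) * ((α * w + 1 - α) * Real.exp (-w))
      = Real.exp (-T) := by
  have hd : ∀ x ∈ Ioi T, HasDerivAt
      (fun w : ℝ => -(Real.exp (-w) * (α * w + 1)) +
        T ^ (1 / α) * α * (w ^ (1 - 1 / α) * Real.exp (-w)))
      ((1 - T ^ (1 / α) * x ^ (-(1 / α))) * ((α * x + 1 - α) * Real.exp (-x))) x := by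
    intro x hx
    have hx0 : 0 < x := hT.trans hx
    have he : HasDerivAt (fun w : ℝ => Real.exp (-w)) (Real.exp (-x) * (-1)) x :=
      (hasDerivAt_neg x).exp
    have hl : HasDerivAt (fun w : ℝ => α * w + 1) (α * 1) x :=
      ((hasDerivAt_id x).const_mul α).add_const 1
    have hr := Real.hasDerivAt_rpow_const (x := x) (p := 1 - 1 / α) (Or.inl hx0.ne')
    have h := ((he.mul hl).neg).add ((hr.mul he).const_mul (T ^ (1 / α) * α))
    refine h.congr_deriv ?_
    have e1 : x ^ (1 - 1 / α) = x * x ^ (-(1 / α)) := by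
      rw [sub_eq_add_neg, Real.rpow_add hx0, Real.rpow_one]
    have e2 : (1 - 1 / α - 1) = -(1 / α) := by ring
    rw [e2, e1]
    have e3 : α * (1 - 1 / α) = α - 1 := by field_simp
    linear_combination (T ^ (1 / α) * x ^ (-(1 / α)) * Real.exp (-x)) * e3
  have hg : IntegrableOn (fun w : ℝ => (α * w + 1 - α) * Real.exp (-w)) (Ioi T) := by
    have h1 := (Real.GammaIntegral_convergent (s := 1) one_pos).const_mul (1 - α)
    have h2 := (Real.GammaIntegral_convergent (s := 2) two_pos).const_mul α
    have h := IntegrableOn.mono_set (h1.add h2) (Ioi_subset_Ioi hT.le)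
    refine h.congr_fun ?_ measurableSet_Ioi
    intro x hx
    norm_num
    ring
  have hi : IntegrableOn (fun w : ℝ => (1 - T ^ (1 / α) * w ^ (-(1 / α))) *
      ((α * w + 1 - α) * Real.exp (-w))) (Ioi T) := by
    refine Integrable.bdd_mul (c := 1) hg ?_ ?_
    · exact (by fun_prop : Measurable
        (fun w : ℝ => (1 - T ^ (1 / α) * w ^ (-(1 / α))))).aestronglyMeasurable
    · filter_upwards [ae_restrict_mem measurableSet_Ioi] with x hx
      have hx0 : 0 < x := hT.trans hx
      have hle : T ^ (1 / α) ≤ x ^ (1 / α) :=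
        Real.rpow_le_rpow hT.le (le_of_lt hx) (by positivity)
      have hp : 0 < x ^ (1 / α) := by positivity
      have hp' : 0 < T ^ (1 / α) := by positivity
      rw [Real.rpow_neg hx0.le, ← div_eq_mul_inv, Real.norm_eq_abs, abs_le]
      have : T ^ (1 / α) / x ^ (1 / α) ≤ 1 := (div_le_one hp).2 hle
      have : 0 < T ^ (1 / α) / x ^ (1 / α) := by positivity
      constructor <;> linarith
  have ht : Filter.Tendsto (fun w : ℝ => -(Real.exp (-w) * (α * w + 1)) +
        T ^ (1 / α) * α * (w ^ (1 - 1 / α) * Real.exp (-w))) Filter.atTop (nhds 0) := by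
    have a0 := tendsto_rpow_mul_exp_neg_mul_atTop_nhds_zero 0 1 one_pos
    have a1 := tendsto_rpow_mul_exp_neg_mul_atTop_nhds_zero 1 1 one_pos
    have a2 := tendsto_rpow_mul_exp_neg_mul_atTop_nhds_zero (1 - 1 / α) 1 one_pos
    have h := (((a1.const_mul α).add a0).neg).add (a2.const_mul (T ^ (1 / α) * α))
    convert h using 2
    · simp only [Real.rpow_one, Real.rpow_zero, neg_mul, one_mul]
      ring
    · simp
  have hc : ContinuousWithinAt (fun w : ℝ => -(Real.exp (-w) * (α * w + 1)) +
        T ^ (1 / α) * α * (w ^ (1 - 1 / α) * Real.exp (-w))) (Ici T) T := by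
    apply ContinuousAt.continuousWithinAt
    have := Real.continuousAt_rpow_const T (1 - 1 / α) (Or.inl hT.ne')
    fun_prop
  rw [integral_Ioi_of_hasDerivAt_of_tendsto hc hd hi ht]
  have : T ^ (1 / α) * T ^ (1 - 1 / α) = T := by
    rw [← Real.rpow_add hT]; simp
  linear_combination (-α * Real.exp (-T)) * this

/-- The alternative representation of the reciprocal bridge prior as a (signed)
mixture of reciprocal Bartlett–Fejér kernels over a two-component gamma mixing
measure. -/
theorem stmt_9 (α lam β : ℝ) (hα : 0 < α) (hlam : 0 < lam) (hβ : β ≠ 0) :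
    (lam ^ (1 / α) / (2 * β ^ 2 * Real.Gamma (1 / α + 1))) *
        Real.exp (-lam * |β| ^ (-α))
      = ∫ w in Ioi (0 : ℝ),
          (lam ^ (1 / α) / (β ^ 2 * w ^ (1 / α))) *
            max (1 - lam ^ (1 / α) / (|β| * w ^ (1 / α))) 0 *
            (((1 + α) / 2) * (1 / Real.Gamma (2 + 1 / α)) * w ^ (1 + 1 / α) *
                Real.exp (-w) +
              ((1 - α) / 2) * (1 / Real.Gamma (1 + 1 / α)) * w ^ (1 / α) *
                Real.exp (-w)) := by
  have hb : 0 < |β| := abs_pos.2 hβ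
  have ha : 0 < 1 / α := by positivity
  obtain ⟨T, hTdef⟩ : ∃ T, T = lam * |β| ^ (-α) := ⟨_, rfl⟩
  have hT : 0 < T := by rw [hTdef]; positivity
  have hTa : T ^ (1 / α) = lam ^ (1 / α) / |β| := by
    rw [hTdef, Real.mul_rpow hlam.le (by positivity), ← Real.rpow_mul hb.le]
    have : -α * (1 / α) = -1 := by field_simp
    rw [this, Real.rpow_neg_one, ← div_eq_mul_inv]
  have hG : 0 < Real.Gamma (1 + 1 / α) := Real.Gamma_pos_of_pos (by positivity)
  have hG2 : Real.Gamma (2 + 1 / α) = (1 + 1 / α) * Real.Gamma (1 + 1 / α) := by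
    rw [← Real.Gamma_add_one (by positivity)]; congr 1; ring
  have hk : ∀ w : ℝ, lam ^ (1 / α) / (|β| * w ^ (1 / α)) = T ^ (1 / α) / w ^ (1 / α) := by
    intro w; rw [hTa, div_div]
  rw [neg_mul, ← hTdef, ← aux_int_s9 α T hα hT, ← integral_const_mul]
  symm
  rw [setIntegral_eq_of_subset_of_forall_sdiff_eq_zero measurableSet_Ioi
    (Ioi_subset_Ioi hT.le) (s := Ioi T)]
  · refine setIntegral_congr_fun measurableSet_Ioi ?_
    intro w hw
    have hw0 : 0 < w := hT.trans hw
    have hp : 0 < w ^ (1 / α) := by positivity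
    have hle : T ^ (1 / α) ≤ w ^ (1 / α) := Real.rpow_le_rpow hT.le (le_of_lt hw) ha.le
    have : T ^ (1 / α) / w ^ (1 / α) ≤ 1 := (div_le_one hp).2 hle
    simp only []
    rw [hk, max_eq_left (by linarith), hG2, Real.rpow_add hw0, Real.rpow_one,
      Real.rpow_neg hw0.le, add_comm (1 / α) 1]
    generalize w ^ (1 / α) = p at *
    generalize T ^ (1 / α) = t at *
    generalize Real.Gamma (1 + 1 / α) = G at *
    have h1 : (1 + 1 / α) = (1 + α) / α := by field_simp; ring
    rw [h1]
    field_simp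
    ring
  · intro w hw
    have hw0 : 0 < w := hw.1
    have hwT : w ≤ T := not_lt.1 hw.2
    have hp : 0 < w ^ (1 / α) := by positivity
    have : 1 ≤ T ^ (1 / α) / w ^ (1 / α) :=
      (one_le_div hp).2 (Real.rpow_le_rpow hw0.le hwT ha.le)
    rw [hk, max_eq_right (by linarith)]
    simp
end

section
/- Let α > 0, τ > 0, and let θ be a nonzero real number. Then (1 + 1/(τ·|θ|))^{−(1+α)} = ∫_{1/|θ|}^∞ ((1+α)/τ)·(1 + t/τ)^{−(2+α)} dt. Equivalently, the reciprocalized generalized double Pareto kernel θ ↦ θ^{−2}·(1 + 1/(τ|θ|))^{−(1+α)} is a scale mixture of inverse uniform (double Pareto) kernels (1/(2tθ²))·1{|θ| > 1/t} with mixing weight proportional to t·(1 + t/τ)^{−(2+α)}. -/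
open MeasureTheory Real Set

/-- The reciprocalized generalized double Pareto kernel is a scale mixture of inverse
uniform (double Pareto) kernels: the defining integral identity. -/
theorem stmt_12 (α τ θ : ℝ) (hα : 0 < α) (hτ : 0 < τ) (hθ : θ ≠ 0) :
    (1 + 1 / (τ * |θ|)) ^ (-(1 + α))
      = ∫ t in Ioi (1 / |θ|),
          ((1 + α) / τ) * (1 + t / τ) ^ (-(2 + α)) := by
  have hθ' : 0 < |θ| := abs_pos.mpr hθ
  have ha : 0 < 1 / |θ| := by positivity
  have hpos : ∀ t ∈ Ici (1 / |θ|), 0 < 1 + t / τ := by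
    intro t ht
    have : 0 < t := lt_of_lt_of_le ha ht
    positivity
  have hderiv : ∀ t ∈ Ici (1 / |θ|),
      HasDerivAt (fun t : ℝ => -(1 + t / τ) ^ (-(1 + α)))
        (((1 + α) / τ) * (1 + t / τ) ^ (-(2 + α))) t := by
    intro t ht
    have h1 : HasDerivAt (fun t : ℝ => 1 + t / τ) (1 / τ) t :=
      ((hasDerivAt_id t).div_const τ).const_add 1
    have h2 := (h1.rpow_const (p := -(1 + α)) (Or.inl (hpos t ht).ne')).neg
    refine h2.congr_deriv ?_
    rw [show -(1 + α) - 1 = -(2 + α) by ring]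
    ring
  have hlim : Filter.Tendsto (fun t : ℝ => -(1 + t / τ) ^ (-(1 + α))) Filter.atTop
      (nhds 0) := by
    have h1 : Filter.Tendsto (fun t : ℝ => 1 + t / τ) Filter.atTop Filter.atTop :=
      Filter.tendsto_atTop_add_const_left _ 1 (Filter.tendsto_id.atTop_div_const hτ)
    have h2 := ((tendsto_rpow_neg_atTop (show 0 < 1 + α by positivity)).comp h1).neg
    simpa using h2
  rw [integral_Ioi_of_hasDerivAt_of_nonneg' hderiv ?_ hlim]
  · rw [zero_sub, neg_neg, div_div, mul_comm τ]
  · intro t ht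
    have := hpos t (Ioi_subset_Ici_self ht)
    positivity
end

section
/- Let τ > 0 and let θ be a nonzero real number. Then log(1 + τ²·θ²) = ∫_{1/|θ|}^∞ 2τ²/(t·(t² + τ²)) dt. Equivalently, the reciprocalized horseshoe-like (logarithm) shrinkage kernel θ ↦ θ^{−2}·log(1 + τ²θ²) is a scale mixture of inverse uniform (double Pareto) kernels (1/(2tθ²))·1{|θ| > 1/t} with mixing weight proportional to (1 + t²/τ²)^{−1}. -/
open MeasureTheory Real Set

/-- The reciprocalized horseshoe-like (logarithm) shrinkage kernel is a scale mixture
of inverse uniform (double Pareto) kernels: the defining integral identity. -/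
theorem stmt_13 (τ θ : ℝ) (hτ : 0 < τ) (hθ : θ ≠ 0) :
    Real.log (1 + τ ^ 2 * θ ^ 2)
      = ∫ t in Ioi (1 / |θ|), 2 * τ ^ 2 / (t * (t ^ 2 + τ ^ 2)) := by
  have ha : 0 < 1 / |θ| := by positivity
  have hderiv : ∀ t ∈ Ici (1 / |θ|),
      HasDerivAt (fun t : ℝ => -Real.log (1 + τ ^ 2 * (t⁻¹) ^ 2))
        (2 * τ ^ 2 / (t * (t ^ 2 + τ ^ 2))) t := by
    intro t ht
    have ht0 : 0 < t := lt_of_lt_of_le ha ht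
    have h1 : HasDerivAt (fun t : ℝ => 1 + τ ^ 2 * (t⁻¹) ^ 2) _ t :=
      (((hasDerivAt_inv ht0.ne').pow 2).const_mul (τ ^ 2)).const_add 1
    have hpos : (1 + τ ^ 2 * (t⁻¹) ^ 2) ≠ 0 := by positivity
    refine (h1.log hpos).neg.congr_deriv ?_
    have h2 : t ^ 2 + τ ^ 2 ≠ 0 := by positivity
    have h3 : (1 + τ ^ 2 * (t⁻¹) ^ 2) = (t ^ 2 + τ ^ 2) / t ^ 2 := by
      field_simp
    rw [h3]
    field_simp
    norm_num
    field_simp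
  have hlim : Filter.Tendsto (fun t : ℝ => -Real.log (1 + τ ^ 2 * (t⁻¹) ^ 2))
      Filter.atTop (nhds 0) := by
    have h1 : Filter.Tendsto (fun t : ℝ => 1 + τ ^ 2 * (t⁻¹) ^ 2) Filter.atTop
        (nhds (1 + τ ^ 2 * 0 ^ 2)) :=
      ((tendsto_inv_atTop_zero.pow 2).const_mul (τ ^ 2)).const_add 1
    have h2 := (h1.log (by norm_num)).neg
    simpa using h2
  rw [integral_Ioi_of_hasDerivAt_of_nonneg' hderiv _ hlim]
  · simp
  · intro t ht
    have ht0 : 0 < t := lt_trans ha ht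
    positivity
end

section
/- For every α > 0 and λ > 0, the Inverse Generalized Gaussian function is a proper probability density on ℝ: ∫_{ℝ} (λ^{1/α}/(2β²·Γ((1/α)+1)))·e^{−λ·|β|^{−α}} dβ = 1, where the integrand is taken to be 0 at β = 0. -/
open MeasureTheory Real Set

/-- For every α > 0 and λ > 0, the Inverse Generalized Gaussian function is a proper
probability density on ℝ. -/
theorem stmt_15 (α lam : ℝ) (hα : 0 < α) (hlam : 0 < lam) :
    ∫ β : ℝ,
        (if β = 0 then 0 else
          (lam ^ (1 / α) / (2 * β ^ 2 * Real.Gamma (1 / α + 1))) *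
            Real.exp (-lam * |β| ^ (-α))) = 1 := by
  have hG : 0 < Real.Gamma (1 / α + 1) := Real.Gamma_pos_of_pos (by positivity)
  have hL : 0 < lam ^ (1 / α) := Real.rpow_pos_of_pos hlam _
  have h1 := integral_comp_abs (f := fun β : ℝ => (if β = 0 then 0 else
          (lam ^ (1 / α) / (2 * β ^ 2 * Real.Gamma (1 / α + 1))) *
            Real.exp (-lam * β ^ (-α))))
  simp only [abs_eq_zero, sq_abs] at h1
  rw [h1]
  have h2 := integral_comp_rpow_Ioi (fun y : ℝ => Real.exp (-lam * y ^ α))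
    (p := -1) (by norm_num)
  rw [integral_exp_neg_mul_rpow hα hlam] at h2
  have h3 : ∫ β in Ioi (0 : ℝ), (if β = 0 then 0 else
          (lam ^ (1 / α) / (2 * β ^ 2 * Real.Gamma (1 / α + 1))) *
            Real.exp (-lam * β ^ (-α))) =
      ∫ x in Ioi (0 : ℝ), (lam ^ (1 / α) / (2 * Real.Gamma (1 / α + 1))) *
        ((|(-1 : ℝ)| * x ^ ((-1 : ℝ) - 1)) • Real.exp (-lam * (x ^ (-1 : ℝ)) ^ α)) := by
    refine setIntegral_congr_fun measurableSet_Ioi fun x hx => ?_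
    have hx' : 0 < x := hx
    have e1 : (x ^ (-1 : ℝ)) ^ α = x ^ (-α) := by
      rw [← Real.rpow_mul hx'.le]; congr 1; ring
    have e2 : x ^ ((-1 : ℝ) - 1) = (x ^ 2)⁻¹ := by
      rw [show ((-1 : ℝ) - 1) = -(2 : ℕ) by norm_num, Real.rpow_neg hx'.le, Real.rpow_natCast]
    simp only [if_neg hx'.ne', e1, e2, smul_eq_mul, abs_neg, abs_one, one_mul]
    field_simp
  rw [h3, integral_const_mul, h2, neg_div, Real.rpow_neg hlam.le]
  field_simp
end
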